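/- Let n ≥ 1, let λ be a D-partition of n, and assume |μ(λ)| ∉ {2, 2n−2}. Set d(λ) = (λ^t)_D. Then |μ(λ)| is even, μ(λ) is a special D-partition, μ(λ) ⊆ d(λ), and d(λ) ∖ μ(λ) is a special D-partition. -/

import Mathlib

namespace WFPaper

/-- The list of parts of a partition (multiset of positive integers) in weakly
decreasing order. -/
def sortedDesc (s : Multiset ℕ) : List ℕ := (s.sort (· ≤ ·)).reverse

/-- The `j`-th largest part of `s` (1-indexed); `0` if `j = 0` or `j > #s`. -/
def part (s : Multiset ℕ) (j : ℕ) : ℕ := (sortedDesc s).getD (j - 1) 0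

/-- The smallest part of `s` (`0` if `s` is empty). -/
def minPart (s : Multiset ℕ) : ℕ := (s.sort (· ≤ ·)).getD 0 0

/-- Sum of the `j` largest parts of `s`. -/
def psum (s : Multiset ℕ) (j : ℕ) : ℕ := ((sortedDesc s).take j).sum

/-- Dominance order: `DomLE a b` means `a ≤ b` in the dominance order, i.e.
for every `j` the sum of the `j` largest parts of `a` is at most that of `b`. -/
def DomLE (a b : Multiset ℕ) : Prop := ∀ j, psum a j ≤ psum b j

/-- All parts are positive. -/
def PosParts (s : Multiset ℕ) : Prop := ∀ x ∈ s, 0 < x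

/-- A partition of an odd number in which every even part has even multiplicity
(a B-partition of `n` when the sum is `2*n+1`). -/
def IsTypeB (s : Multiset ℕ) : Prop :=
  PosParts s ∧ Odd s.sum ∧ ∀ x, Even x → Even (s.count x)

/-- A partition of an even number in which every odd part has even multiplicity
(a C-partition of `n` when the sum is `2*n`). -/
def IsTypeC (s : Multiset ℕ) : Prop :=
  PosParts s ∧ Even s.sum ∧ ∀ x, Odd x → Even (s.count x)

/-- A partition of an even number in which every even part has even multiplicity
(a D-partition of `n` when the sum is `2*n`). -/
def IsTypeD (s : Multiset ℕ) : Prop :=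
  PosParts s ∧ Even s.sum ∧ ∀ x, Even x → Even (s.count x)

/-- `IsCollapse T α β` : `β` is the dominance-largest partition of class `T` of
the same number as `α` which is dominated by `α` (e.g. the B/C/D-collapse of `α`
for `T = IsTypeB/IsTypeC/IsTypeD`). -/
def IsCollapse (T : Multiset ℕ → Prop) (α β : Multiset ℕ) : Prop :=
  T β ∧ β.sum = α.sum ∧ DomLE β α ∧
    ∀ γ, T γ → γ.sum = α.sum → DomLE γ α → DomLE γ β

/-- The transpose (conjugate) partition: its `j`-th part (0-indexed `j`) is the
number of parts of `s` that are `≥ j+1`. -/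
def transpose (s : Multiset ℕ) : Multiset ℕ :=
  (Multiset.range (part s 1)).map (fun j => (s.filter (fun x => j + 1 ≤ x)).card)

/-- `λ⁻` : subtract 1 from the smallest part (the part being deleted if it
becomes 0). -/
def decMin (s : Multiset ℕ) : Multiset ℕ :=
  ((minPart s - 1) ::ₘ s.erase (minPart s)).filter (fun x => 0 < x)

/-- `λ⁺` : add 1 to the largest part. -/
def incMax (s : Multiset ℕ) : Multiset ℕ :=
  (part s 1 + 1) ::ₘ s.erase (part s 1)

/-- The subpartition `μ` of `T` whose multiplicity at an even `x` is 2 if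
`m_T(x)` is even and nonzero, 1 if `m_T(x)` is odd, and 0 at odd `x`. -/
def muEven (T : Multiset ℕ) : Multiset ℕ :=
  (T.toFinset.filter (fun x => Even x)).val.bind
    (fun x => Multiset.replicate (if Even (T.count x) then 2 else 1) x)

/-- The subpartition `μ` of `T` whose multiplicity at an odd `x` is 2 if
`m_T(x)` is even and nonzero, 1 if `m_T(x)` is odd, and 0 at even `x`. -/
def muOdd (T : Multiset ℕ) : Multiset ℕ :=
  (T.toFinset.filter (fun x => Odd x)).val.bind
    (fun x => Multiset.replicate (if Even (T.count x) then 2 else 1) x)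

/-- The subpartition `π` of `T` consisting of the even parts of `T` of odd
multiplicity, each taken once. -/
def piEven (T : Multiset ℕ) : Multiset ℕ :=
  (T.toFinset.filter (fun x => Even x ∧ Odd (T.count x))).val

/-- `k` is a (1-indexed) position of an odd part of `s`. -/
def OddIdx (s : Multiset ℕ) (k : ℕ) : Prop := 1 ≤ k ∧ Odd (part s k)

/-- `k` is a (1-indexed) position of an even part of `s`. -/
def EvenIdx (s : Multiset ℕ) (k : ℕ) : Prop :=
  1 ≤ k ∧ k ≤ Multiset.card s ∧ Even (part s k)

/-- `e_s(i,j)` : number of positions `i ≤ k ≤ j` with `s_k` even. -/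
def eCount (s : Multiset ℕ) (i j : ℕ) : ℕ :=
  ((Finset.Icc i j).filter (fun k => Even (part s k))).card

/-- number of positions `i ≤ k ≤ j` with `s_k` odd. -/
def oCount (s : Multiset ℕ) (i j : ℕ) : ℕ :=
  ((Finset.Icc i j).filter (fun k => Odd (part s k))).card

/-- `s` is special in the e-count sense: `e_s(1,t₁)` is even, and
`e_s(tᵢ,tᵢ₊₁)` is even for all `1 ≤ i ≤ p-1`, where `t₁ < ⋯ < t_p` are the
positions of the odd parts of `s`. -/
def IsSpecialE (s : Multiset ℕ) : Prop :=
  (∀ t, OddIdx s t → (∀ t', OddIdx s t' → t ≤ t') → Even (eCount s 1 t)) ∧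
  (∀ i j, OddIdx s i → OddIdx s j → i < j →
    (∀ k, OddIdx s k → k ≤ i ∨ j ≤ k) → Even (eCount s i j))

/-- `s` is quasi-special: `e_s(1,t₁)` is even, `e_s(tᵢ,tᵢ₊₁)` is even for all
`1 ≤ i ≤ p-2`, and the smallest part of `s` is odd with multiplicity 1. -/
def IsQuasiSpecialE (s : Multiset ℕ) : Prop :=
  (∀ t, OddIdx s t → (∀ t', OddIdx s t' → t ≤ t') → Even (eCount s 1 t)) ∧
  (∀ i j, OddIdx s i → OddIdx s j → i < j →
    (∀ k, OddIdx s k → k ≤ i ∨ j ≤ k) → (∃ k, OddIdx s k ∧ j < k) →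
      Even (eCount s i j)) ∧
  Odd (minPart s) ∧ s.count (minPart s) = 1

/-- Number of odd parts greater than every even part (equals the number of odd
parts greater than the largest even part, and the number of all odd parts if
there are no even parts). -/
def numOddDominant (s : Multiset ℕ) : ℕ :=
  (s.filter (fun x => Odd x ∧ ∀ y ∈ s, Even y → y < x)).card

/-- Between every pair of consecutive even parts of `s` (in the decreasing
listing of the parts) there is an even number of odd parts. -/
def EvenBetween (s : Multiset ℕ) : Prop :=
  ∀ i j, EvenIdx s i → EvenIdx s j → i < j →
    (∀ k, EvenIdx s k → k ≤ i ∨ j ≤ k) → Even (oCount s i j)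

/-- A special B-partition. -/
def IsSpecialTypeB (s : Multiset ℕ) : Prop :=
  IsTypeB s ∧ EvenBetween s ∧ Odd (numOddDominant s)

/-- A special D-partition. -/
def IsSpecialTypeD (s : Multiset ℕ) : Prop :=
  IsTypeD s ∧ EvenBetween s ∧ Even (numOddDominant s)

section Sequences

open Finset

/-- The parts of `s` in weakly decreasing order, 0-indexed and extended by zeros. -/
def partSeq (s : Multiset ℕ) (k : ℕ) : ℕ := (sortedDesc s).getD k 0

lemma sortedDesc_pairwise (s : Multiset ℕ) : (sortedDesc s).Pairwise (· ≥ ·) := by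
  rw [sortedDesc, List.pairwise_reverse]
  exact Multiset.pairwise_sort s (· ≤ ·)

lemma coe_sortedDesc (s : Multiset ℕ) : (sortedDesc s : Multiset ℕ) = s := by
  simp [sortedDesc]

lemma length_sortedDesc (s : Multiset ℕ) : (sortedDesc s).length = s.card := by
  simp [sortedDesc]

lemma part_eq_partSeq (s : Multiset ℕ) (k : ℕ) : part s k = partSeq s (k - 1) := rfl

lemma partSeq_of_card_le {s : Multiset ℕ} {k : ℕ} (h : s.card ≤ k) : partSeq s k = 0 := by
  rw [partSeq, List.getD_eq_default]
  rwa [length_sortedDesc]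

lemma partSeq_antitone (s : Multiset ℕ) : Antitone (partSeq s) := by
  intro i j hij
  rcases lt_or_ge j s.card with hj | hj
  · rcases hij.eq_or_lt with rfl | hlt
    · rfl
    · rw [← length_sortedDesc] at hj
      rw [partSeq, partSeq, List.getD_eq_getElem _ _ hj, List.getD_eq_getElem _ _ (hlt.trans hj)]
      exact List.pairwise_iff_getElem.1 (sortedDesc_pairwise s) i j _ _ hlt
  · rw [partSeq_of_card_le hj]
    exact Nat.zero_le _

lemma psum_eq_sum_partSeq (s : Multiset ℕ) (j : ℕ) :
    psum s j = ∑ i ∈ range j, partSeq s i := by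
  unfold psum partSeq
  generalize sortedDesc s = L
  induction L generalizing j with
  | nil => simp
  | cons a L ih =>
    cases j with
    | zero => simp
    | succ j => rw [sum_range_succ']; simp [ih, add_comm]

lemma psum_of_card_le {s : Multiset ℕ} {j : ℕ} (h : s.card ≤ j) : psum s j = s.sum := by
  rw [← length_sortedDesc] at h
  rw [psum, List.take_of_length_le h, ← Multiset.sum_coe, coe_sortedDesc]

lemma map_partSeq_range (s : Multiset ℕ) :
    (Multiset.range s.card).map (partSeq s) = s := by
  conv_rhs => rw [← coe_sortedDesc s]
  rw [← Multiset.coe_range, Multiset.map_coe]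
  congr 1
  apply List.ext_getElem
  · simp [length_sortedDesc]
  · intro i h₁ h₂
    simp [partSeq, h₂]

lemma countP_eq_card_filter (s : Multiset ℕ) (P : ℕ → Prop) [DecidablePred P] (h0 : ¬ P 0)
    {N : ℕ} (hN : s.card ≤ N) :
    s.countP P = #{i ∈ range N | P (partSeq s i)} := by
  conv_lhs => rw [← map_partSeq_range s]
  rw [Multiset.countP_map]
  change #{i ∈ range s.card | P (partSeq s i)} = _
  congr 1
  ext i
  simp only [mem_filter, mem_range]
  constructor
  · rintro ⟨h₁, h₂⟩
    exact ⟨by omega, h₂⟩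
  · rintro ⟨-, h₂⟩
    refine ⟨?_, h₂⟩
    by_contra hi
    rw [partSeq_of_card_le (by omega)] at h₂
    exact h0 h₂

lemma partSeq_mem {s : Multiset ℕ} {k : ℕ} (hk : k < s.card) : partSeq s k ∈ s := by
  have h := Multiset.mem_map_of_mem (partSeq s) (Multiset.mem_range.2 hk)
  rwa [map_partSeq_range] at h

lemma exists_partSeq_eq {s : Multiset ℕ} {x : ℕ} (hx : x ∈ s) :
    ∃ k < s.card, partSeq s k = x := by
  rw [← map_partSeq_range s] at hx
  obtain ⟨k, hk, h⟩ := Multiset.mem_map.1 hx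
  exact ⟨k, Multiset.mem_range.1 hk, h⟩

lemma partSeq_eq_of_domLE {s t : Multiset ℕ} (h₁ : DomLE s t) (h₂ : DomLE t s) :
    partSeq s = partSeq t := by
  funext k
  have a := (h₁ k).antisymm (h₂ k)
  have b := (h₁ (k + 1)).antisymm (h₂ (k + 1))
  simp only [psum_eq_sum_partSeq, sum_range_succ] at a b
  omega

/-- A weakly decreasing sequence that reaches `0` is the sequence of parts of a partition. -/
lemma exists_partSeq_eq_of_antitone {g : ℕ → ℕ} (hg : Antitone g) (h0 : ∃ N, g N = 0) :
    ∃ c : Multiset ℕ, PosParts c ∧ partSeq c = g := by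
  classical
  let N := Nat.find h0
  have hN : g N = 0 := Nat.find_spec h0
  have hpos : ∀ i < N, 0 < g i := fun i hi => Nat.pos_of_ne_zero (Nat.find_min h0 hi)
  refine ⟨((List.range N).map g : List ℕ), ?_, ?_⟩
  · intro x hx
    simp only [Multiset.mem_coe, List.mem_map, List.mem_range] at hx
    obtain ⟨i, hi, rfl⟩ := hx
    exact hpos i hi
  · have hs : sortedDesc ((List.range N).map g : List ℕ) = (List.range N).map g := by
      refine List.Perm.eq_of_pairwise (le := (· ≥ ·)) (fun a b _ _ h h' => le_antisymm h' h)
        (sortedDesc_pairwise _) ?_ (Multiset.coe_eq_coe.1 (coe_sortedDesc _))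
      rw [List.pairwise_map]
      exact List.pairwise_lt_range.imp fun h => hg h.le
    funext k
    rw [partSeq, hs]
    rcases lt_or_ge k N with hk | hk
    · simp [hk]
    · rw [List.getD_eq_default _ _ (by simpa using hk)]
      have := hg hk
      omega

end Sequences

section Parity

open Finset

lemma countP_mod_two_eq {s t : Multiset ℕ} (P : ℕ → Prop) [DecidablePred P]
    (h : ∀ x, P x → s.count x % 2 = t.count x % 2) : s.countP P % 2 = t.countP P % 2 := by
  have key : ∀ u : Multiset ℕ, u ≤ s + t →
      u.countP P = ∑ x ∈ (s + t).toFinset, (u.filter P).count x := by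
    intro u hu
    rw [Multiset.countP_eq_card_filter, Multiset.sum_count_eq_card]
    intro a ha
    exact Multiset.mem_toFinset.2 (Multiset.mem_of_le hu (Multiset.mem_of_mem_filter ha))
  rw [key s (Multiset.le_add_right s t), key t (Multiset.le_add_left t s)]
  rw [Finset.sum_nat_mod, Finset.sum_nat_mod (f := fun x => (t.filter P).count x)]
  congr 1
  refine Finset.sum_congr rfl fun x _ => ?_
  by_cases hx : P x
  · rw [Multiset.count_filter_of_pos hx, Multiset.count_filter_of_pos hx, h x hx]
  · rw [Multiset.count_filter_of_neg hx, Multiset.count_filter_of_neg hx]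

lemma even_countP {s : Multiset ℕ} (P : ℕ → Prop) [DecidablePred P]
    (h : ∀ x, P x → Even (s.count x)) : Even (s.countP P) := by
  rw [Nat.even_iff, countP_mod_two_eq (t := 0) P fun x hx => by simpa using Nat.even_iff.1 (h x hx)]
  simp

lemma sum_mod_two_eq_countP_odd (s : Multiset ℕ) :
    s.sum % 2 = s.countP (fun x => Odd x) % 2 := by
  induction s using Multiset.induction with
  | empty => simp
  | cons a s ih =>
    rw [Multiset.sum_cons, Multiset.countP_cons]
    simp only [Nat.odd_iff] at *
    split_ifs <;> omega

lemma sum_mod_two_eq_card_odd (f : ℕ → ℕ) (k : ℕ) :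
    (∑ i ∈ range k, f i) % 2 = #{i ∈ range k | Odd (f i)} % 2 := by
  have := Finset.odd_sum_iff_odd_card_odd (s := range k) f
  simp only [Nat.odd_iff] at *
  omega

lemma sum_add_mod_two_eq_card_even (f : ℕ → ℕ) (k : ℕ) :
    (∑ i ∈ range k, f i + k) % 2 = #{i ∈ range k | Even (f i)} % 2 := by
  have := sum_mod_two_eq_card_odd (fun i => f i + 1) k
  simpa [sum_add_distrib, Nat.odd_add_one] using this

end Parity

section TypeD

open Finset

/-- In a D-partition, the number of even parts among the first `k + 1` is even as soon as the
`k`-th part (0-indexed) is odd or is followed by a smaller one. -/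
lemma IsTypeD.even_sum_add {s : Multiset ℕ} (hs : IsTypeD s) {k : ℕ}
    (hk : partSeq s (k + 1) < partSeq s k ∨ Odd (partSeq s k)) :
    (∑ i ∈ range (k + 1), partSeq s i + (k + 1)) % 2 = 0 := by
  have hpos : 0 < partSeq s k := by
    rcases hk with h | h
    · omega
    · exact h.pos
  have hcard : k < s.card := by
    by_contra h
    rw [partSeq_of_card_le (by omega)] at hpos
    exact hpos.false
  rw [sum_add_mod_two_eq_card_even]
  have h := even_countP (s := s) (fun x => Even x ∧ partSeq s k ≤ x) fun x hx => hs.2.2 x hx.1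
  rw [countP_eq_card_filter s _ (by simp; omega) le_rfl, Nat.even_iff] at h
  rw [← h]
  congr 2
  ext i
  simp only [mem_filter, mem_range]
  constructor
  · rintro ⟨h₁, h₂⟩
    exact ⟨by omega, h₂, partSeq_antitone s (by omega)⟩
  · rintro ⟨-, h₂, h₃⟩
    refine ⟨?_, h₂⟩
    by_contra hi
    have := partSeq_antitone s (show k + 1 ≤ i by omega)
    have := partSeq_antitone s (show k ≤ i by omega)
    have heq : partSeq s i = partSeq s k := by omega
    rcases hk with h | h
    · omega
    · rw [heq] at h₂
      exact Nat.not_even_iff_odd.2 h h₂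

/-- A partition with an even number of even parts before each descent has even parts of even
multiplicity. -/
lemma even_count_of_even_sum_add {s : Multiset ℕ}
    (h : ∀ k, partSeq s (k + 1) < partSeq s k →
      (∑ i ∈ range (k + 1), partSeq s i + (k + 1)) % 2 = 0)
    {y : ℕ} (hy : Even y) (hy0 : 0 < y) : Even (s.count y) := by
  have hz : partSeq s s.card = 0 := partSeq_of_card_le le_rfl
  have hcut : ∀ v, 0 < v → ∃ a ≤ s.card, (∀ i, i < a ↔ v ≤ partSeq s i) ∧
      (∑ i ∈ range a, partSeq s i + a) % 2 = 0 := by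
    intro v hv
    have hex : ∃ a, partSeq s a < v := ⟨s.card, by omega⟩
    refine ⟨Nat.find hex, Nat.find_min' hex (by omega), fun i => ?_, ?_⟩
    · constructor
      · intro hi
        exact not_lt.1 (Nat.find_min hex hi)
      · intro hi
        by_contra hlt
        have := partSeq_antitone s (not_lt.1 hlt)
        have := Nat.find_spec hex
        omega
    · rcases hfind : Nat.find hex with _ | k
      · simp
      · refine h k ?_
        have h₁ := Nat.find_spec hex
        have h₂ := Nat.find_min hex (m := k) (by omega)
        rw [hfind] at h₁
        omega
  obtain ⟨a, -, ha, hae⟩ := hcut (y + 1) (by omega)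
  obtain ⟨b, hbN, hb, hbe⟩ := hcut y hy0
  have hab : a ≤ b := by
    by_contra hlt
    have h₁ := (ha b).1 (by omega)
    have h₂ := (hb b).2 (by omega)
    omega
  have hcount : s.count y = b - a := by
    rw [Multiset.count, countP_eq_card_filter s _ (by omega) le_rfl, ← Nat.card_Ico]
    congr 1
    ext i
    have := ha i
    have := hb i
    simp only [mem_filter, mem_range, mem_Ico]
    omega
  have hsum : ∑ i ∈ range b, partSeq s i = ∑ i ∈ range a, partSeq s i + (b - a) * y := by
    rw [← sum_range_add_sum_Ico _ hab, sum_const_nat (s := Ico a b) (m := y), Nat.card_Ico]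
    intro i hi
    have := ha i
    have := hb i
    rw [mem_Ico] at hi
    omega
  obtain ⟨z, rfl⟩ := hy
  rw [hsum, show (b - a) * (z + z) = 2 * ((b - a) * z) by ring] at hbe
  rw [hcount, Nat.even_iff]
  omega

lemma isSpecialTypeD_of_even_countP {s : Multiset ℕ} (hs : IsTypeD s)
    (h : ∀ y ∈ s, Even y → Even (s.countP fun x => Odd x ∧ y < x)) : IsSpecialTypeD s := by
  refine ⟨hs, ?_, ?_⟩
  · have hcount : ∀ k < s.card, Even (partSeq s k) →
        #{i ∈ range k | Odd (partSeq s i)} % 2 = 0 := by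
      intro k hk hev
      have := h _ (partSeq_mem hk) hev
      rw [countP_eq_card_filter s _ (by simp) le_rfl, Nat.even_iff] at this
      rw [← this]
      congr 2
      ext i
      simp only [mem_filter, mem_range]
      constructor
      · rintro ⟨h₁, h₂⟩
        refine ⟨by omega, h₂, lt_of_le_of_ne (partSeq_antitone s h₁.le) fun heq => ?_⟩
        rw [← heq] at h₂
        exact Nat.not_even_iff_odd.2 h₂ hev
      · rintro ⟨-, h₂, h₃⟩
        refine ⟨?_, h₂⟩
        by_contra hlt
        have := partSeq_antitone s (not_lt.1 hlt)
        omega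
    rintro i j ⟨hi, hi', hie⟩ ⟨hj, hj', hje⟩ hij -
    rw [part_eq_partSeq] at hie hje
    have h₁ := hcount (i - 1) (by omega) hie
    have h₂ := hcount (j - 1) (by omega) hje
    have hsub : {a ∈ range (j - 1) | Odd (partSeq s a)} =
        {a ∈ range (i - 1) | Odd (partSeq s a)} ∪
          {a ∈ Ico (i - 1) j | Odd (partSeq s a)} := by
      ext a
      simp only [mem_union, mem_filter, mem_range, mem_Ico]
      constructor
      · rintro ⟨h₁, h₂⟩
        by_cases h : a < i - 1
        · exact Or.inl ⟨h, h₂⟩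
        · exact Or.inr ⟨by omega, h₂⟩
      · rintro (⟨h₁, h₂⟩ | ⟨h₁, h₂⟩)
        · exact ⟨by omega, h₂⟩
        · refine ⟨?_, h₂⟩
          by_contra hlt
          have : a = j - 1 := by omega
          rw [this] at h₂
          exact Nat.not_even_iff_odd.2 h₂ hje
    have hoc : oCount s i j = #{a ∈ Ico (i - 1) j | Odd (partSeq s a)} := by
      rw [oCount]
      refine card_bij (fun a _ => a - 1) ?_ ?_ ?_
      · intro a ha
        rw [mem_filter, mem_Icc, part_eq_partSeq] at ha
        rw [mem_filter, mem_Ico]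
        exact ⟨by omega, ha.2⟩
      · intro a ha b hb hab
        simp only [mem_filter, mem_Icc] at ha hb
        omega
      · intro a ha
        simp only [mem_filter, mem_Ico] at ha
        refine ⟨a + 1, ?_, by simp⟩
        rw [mem_filter, mem_Icc, part_eq_partSeq]
        exact ⟨by omega, by simpa using ha.2⟩
    rw [hsub, card_union_of_disjoint] at h₂
    · rw [hoc, Nat.even_iff]
      omega
    · rw [disjoint_left]
      intro a ha hb
      simp only [mem_filter, mem_range, mem_Ico] at ha hb
      omega
  · rw [numOddDominant, ← Multiset.countP_eq_card_filter]
    by_cases hne : ∃ y ∈ s, Even y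
    · have hne' : (s.toFinset.filter (fun y => Even y)).Nonempty := by
        obtain ⟨y, hy, hye⟩ := hne
        exact ⟨y, by simp [hy, hye]⟩
      have hmem := max'_mem _ hne'
      have hle : ∀ y ∈ s, Even y → y ≤ (s.toFinset.filter (fun y => Even y)).max' hne' := fun y hy hye =>
        le_max' (s.toFinset.filter (fun y => Even y)) y (by simp [hy, hye])
      generalize (s.toFinset.filter (fun y => Even y)).max' hne' = m at hmem hle
      simp only [mem_filter, Multiset.mem_toFinset] at hmem
      convert h m hmem.1 hmem.2 using 1
      refine Multiset.countP_congr rfl fun x _ => ?_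
      exact propext (and_congr_right fun _ => ⟨fun hx => hx m hmem.1 hmem.2,
        fun hx y hy hye => (hle y hy hye).trans_lt hx⟩)
    · push Not at hne
      have := sum_mod_two_eq_countP_odd s
      rw [Nat.even_iff.1 hs.2.1] at this
      rw [Nat.even_iff, this]
      congr 1
      refine Multiset.countP_congr rfl fun x _ => ?_
      exact propext ⟨fun hx => hx.1, fun hx =>
        ⟨hx, fun y hy hye => absurd hye (hne y hy)⟩⟩

end TypeD

section Collapse

open Finset

/-- The amount by which the sum of the `k` largest parts drops under the D-collapse of the
partition with sequence of parts `f`. -/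
def collapseDefect (f : ℕ → ℕ) (k : ℕ) : ℕ :=
  if (∑ i ∈ range k, f i + k) % 2 = 1 ∧ ¬ (f (k - 1) = f k ∧ f k % 2 = 0) then 1 else 0

/-- The sequence of parts of the D-collapse of the partition with sequence of parts `f`. -/
def collapseSeq (f : ℕ → ℕ) (k : ℕ) : ℕ := f k + collapseDefect f k - collapseDefect f (k + 1)

lemma collapseDefect_zero (f : ℕ → ℕ) : collapseDefect f 0 = 0 := by
  simp [collapseDefect]

lemma collapseDefect_succ_le {f : ℕ → ℕ} (hf : Antitone f) (k : ℕ) :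
    collapseDefect f (k + 1) ≤ f k + collapseDefect f k := by
  have := hf (Nat.le_add_right k 1)
  simp only [collapseDefect, sum_range_succ, Nat.add_sub_cancel]
  split_ifs <;> omega

lemma sum_collapseSeq_add {f : ℕ → ℕ} (hf : Antitone f) (k : ℕ) :
    ∑ i ∈ range k, collapseSeq f i + collapseDefect f k = ∑ i ∈ range k, f i := by
  induction k with
  | zero => simp [collapseDefect_zero]
  | succ k ih =>
    have := collapseDefect_succ_le hf k
    rw [sum_range_succ, sum_range_succ, collapseSeq]
    omega

lemma collapseSeq_antitone {f : ℕ → ℕ} (hf : Antitone f) : Antitone (collapseSeq f) := by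
  refine antitone_nat_of_succ_le fun k => ?_
  have := hf (Nat.le_add_right k 1)
  have := hf (Nat.le_add_right (k + 1) 1)
  simp only [collapseSeq, collapseDefect, sum_range_succ, Nat.add_sub_cancel]
  split_ifs <;> omega

lemma collapseDefect_eq_zero_of_even {f : ℕ → ℕ} {k : ℕ}
    (h : collapseSeq f k % 2 = 0) :
    collapseDefect f k = 0 ∧ collapseSeq f k = f k := by
  revert h
  simp only [collapseSeq, collapseDefect, sum_range_succ, Nat.add_sub_cancel]
  split_ifs <;> omega

lemma collapseSeq_of_odd {f : ℕ → ℕ} {k : ℕ} (h : f k % 2 = 1) :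
    collapseSeq f k = f k := by
  simp only [collapseSeq, collapseDefect, sum_range_succ, Nat.add_sub_cancel]
  split_ifs <;> omega

lemma even_sum_collapseSeq_add {f : ℕ → ℕ} (hf : Antitone f) {k : ℕ}
    (hk : collapseSeq f (k + 1) < collapseSeq f k) :
    (∑ i ∈ range (k + 1), collapseSeq f i + (k + 1)) % 2 = 0 := by
  have h := sum_collapseSeq_add hf (k + 1)
  revert h hk
  generalize ∑ i ∈ range (k + 1), collapseSeq f i = G
  simp only [collapseSeq, collapseDefect, sum_range_succ, Nat.add_sub_cancel]
  split_ifs <;> omega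

lemma domLE_collapse {T γ : Multiset ℕ} (hγ : IsTypeD γ) (h : DomLE γ T) (k : ℕ) :
    psum γ k + collapseDefect (partSeq T) k ≤ psum T k := by
  have h₁ := h k
  rw [collapseDefect]
  split_ifs with hd
  · obtain ⟨hodd, hne⟩ := hd
    rcases k with _ | k
    · simp at hodd
    rw [Nat.add_sub_cancel] at hne
    by_contra hlt
    have h₀ := h k
    have h₂ := h (k + 1 + 1)
    have hev := hγ.even_sum_add (k := k)
    have hT := partSeq_antitone T (Nat.le_add_right k 1)
    have hγa := partSeq_antitone γ (Nat.le_add_right k 1)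
    rw [psum_eq_sum_partSeq, psum_eq_sum_partSeq] at h₀ h₁ h₂ hlt
    rw [Nat.odd_iff] at hev
    simp only [sum_range_succ] at *
    omega
  · omega

lemma IsCollapse.partSeq_eq {T d : Multiset ℕ} (hd : IsCollapse IsTypeD T d) :
    partSeq d = collapseSeq (partSeq T) := by
  have hf := partSeq_antitone T
  have hzero : ∀ k, T.card ≤ k → partSeq T k = 0 := fun k hk => partSeq_of_card_le hk
  have hdz : ∀ k, T.card + 1 ≤ k → collapseDefect (partSeq T) k = 0 := by
    intro k hk
    rw [collapseDefect, hzero k (by omega), hzero (k - 1) (by omega)]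
    simp
  obtain ⟨c, hcpos, hc⟩ := exists_partSeq_eq_of_antitone (collapseSeq_antitone hf)
    ⟨T.card + 1, by
      rw [collapseSeq, hzero _ (by omega), hdz _ le_rfl]
      simp⟩
  have hpsum : ∀ k, psum c k + collapseDefect (partSeq T) k = psum T k := by
    intro k
    rw [psum_eq_sum_partSeq, psum_eq_sum_partSeq, hc, sum_collapseSeq_add hf]
  have hsum : c.sum = T.sum := by
    have := hpsum (c.card + T.card + 1)
    rwa [hdz _ (by omega), psum_of_card_le (by omega), psum_of_card_le (by omega)] at this
  have hcD : IsTypeD c := by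
    refine ⟨hcpos, ?_, fun x hx => ?_⟩
    · rw [hsum, ← hd.2.1]
      exact hd.1.2.1
    · rcases Nat.eq_zero_or_pos x with rfl | hx0
      · rw [Multiset.count_eq_zero_of_notMem fun h => (hcpos 0 h).false]
        exact Even.zero
      · refine even_count_of_even_sum_add (fun k hk => ?_) hx hx0
        rw [hc] at hk ⊢
        exact even_sum_collapseSeq_add hf hk
  rw [← hc]
  refine partSeq_eq_of_domLE (fun k => ?_) (hd.2.2.2 c hcD hsum fun k => ?_)
  · have := domLE_collapse hd.1 hd.2.2.1 k
    have := hpsum k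
    omega
  · have := hpsum k
    omega

lemma IsCollapse.count_le_of_odd {T d : Multiset ℕ} (hd : IsCollapse IsTypeD T d) {x : ℕ}
    (hx : Odd x) : T.count x ≤ d.count x := by
  have h0 : ¬ x = 0 := hx.pos.ne'
  unfold Multiset.count
  rw [countP_eq_card_filter T _ h0 (Nat.le_add_right _ d.card),
    countP_eq_card_filter d _ h0 (Nat.le_add_left _ T.card), hd.partSeq_eq]
  refine card_le_card fun i hi => ?_
  simp only [mem_filter] at hi ⊢
  rw [collapseSeq_of_odd (by rw [← hi.2]; exact Nat.odd_iff.1 hx)]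
  exact hi

lemma IsCollapse.countP_odd_mod_two {T d : Multiset ℕ} (hd : IsCollapse IsTypeD T d) {y : ℕ}
    (hy : y ∈ d) (hye : Even y) :
    d.countP (fun x => Odd x ∧ y < x) % 2 = T.countP (fun x => Odd x ∧ y < x) % 2 := by
  obtain ⟨k, hk, rfl⟩ := exists_partSeq_eq hy
  have hseq := hd.partSeq_eq
  have hev := Nat.even_iff.1 hye
  have hdef := collapseDefect_eq_zero_of_even (f := partSeq T) (k := k) (by rw [← hseq]; exact hev)
  have key : ∀ s : Multiset ℕ, partSeq s k = partSeq d k →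
      s.countP (fun x => Odd x ∧ partSeq d k < x) % 2 =
        (∑ i ∈ range k, partSeq s i) % 2 := by
    intro s hs
    rw [countP_eq_card_filter s _ (by simp) (Nat.le_add_right _ k), sum_mod_two_eq_card_odd]
    congr 2
    ext i
    simp only [mem_filter, mem_range]
    constructor
    · rintro ⟨-, h₂, h₃⟩
      refine ⟨?_, h₂⟩
      by_contra hlt
      have := partSeq_antitone s (not_lt.1 hlt)
      omega
    · rintro ⟨h₁, h₂⟩
      have := partSeq_antitone s h₁.le
      have := Nat.odd_iff.1 h₂
      exact ⟨by omega, h₂, by omega⟩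
  have hsum := sum_collapseSeq_add (partSeq_antitone T) k
  rw [key d rfl, key T (by rw [hseq, hdef.2]), ← hsum, hdef.1, hseq, add_zero]

end Collapse

section MuOdd

lemma count_muOdd (T : Multiset ℕ) (x : ℕ) :
    (muOdd T).count x =
      if Odd x ∧ x ∈ T then (if Even (T.count x) then 2 else 1) else 0 := by
  rw [muOdd, Multiset.count_bind]
  change ∑ y ∈ T.toFinset.filter (fun x => Odd x), _ = _
  simp only [Multiset.count_replicate]
  rw [Finset.sum_ite_eq']
  simp [and_comm]

lemma count_muOdd_of_even (T : Multiset ℕ) {x : ℕ} (hx : Even x) : (muOdd T).count x = 0 := by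
  rw [count_muOdd, if_neg fun h => Nat.not_even_iff_odd.2 h.1 hx]

lemma count_muOdd_mod_two (T : Multiset ℕ) {x : ℕ} (hx : Odd x) :
    (muOdd T).count x % 2 = T.count x % 2 := by
  rw [count_muOdd]
  have := Multiset.count_eq_zero (s := T) (a := x)
  by_cases hm : x ∈ T
  · simp only [hx, hm, and_self, if_true, Nat.even_iff]
    split_ifs <;> omega
  · simp [hm]

lemma count_muOdd_le (T : Multiset ℕ) (x : ℕ) : (muOdd T).count x ≤ T.count x := by
  rw [count_muOdd]
  split_ifs with h₁ h₂
  · have := Multiset.count_pos.2 h₁.2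
    rw [Nat.even_iff] at h₂
    omega
  · exact Multiset.count_pos.2 h₁.2
  · exact Nat.zero_le _

lemma odd_of_mem_muOdd {T : Multiset ℕ} {x : ℕ} (hx : x ∈ muOdd T) : Odd x := by
  by_contra h
  have := Multiset.count_pos.2 hx
  rw [count_muOdd_of_even T (Nat.not_odd_iff_even.1 h)] at this
  exact this.false

lemma sum_muOdd_mod_two (T : Multiset ℕ) : (muOdd T).sum % 2 = T.sum % 2 := by
  rw [sum_mod_two_eq_countP_odd, sum_mod_two_eq_countP_odd]
  exact countP_mod_two_eq _ fun x hx => count_muOdd_mod_two T hx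

lemma isSpecialTypeD_muOdd {T : Multiset ℕ} (hT : Even T.sum) : IsSpecialTypeD (muOdd T) := by
  refine isSpecialTypeD_of_even_countP ⟨fun x hx => (odd_of_mem_muOdd hx).pos, ?_, fun x hx => ?_⟩
    fun y hy hye => absurd hye (Nat.not_even_iff_odd.2 (odd_of_mem_muOdd hy))
  · rw [Nat.even_iff, sum_muOdd_mod_two, ← Nat.even_iff]
    exact hT
  · simp [count_muOdd_of_even T hx]

lemma IsCollapse.muOdd_le {T d : Multiset ℕ} (hd : IsCollapse IsTypeD T d) : muOdd T ≤ d := by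
  rw [Multiset.le_iff_count]
  intro x
  rcases Nat.even_or_odd x with hx | hx
  · rw [count_muOdd_of_even T hx]
    exact Nat.zero_le _
  · exact (count_muOdd_le T x).trans (hd.count_le_of_odd hx)

lemma IsCollapse.isSpecialTypeD_sub {T d : Multiset ℕ} (hd : IsCollapse IsTypeD T d) :
    IsSpecialTypeD (d - muOdd T) := by
  have hadd := Multiset.sub_add_cancel hd.muOdd_le
  refine isSpecialTypeD_of_even_countP
    ⟨fun x hx => hd.1.1 x (Multiset.mem_of_le (Multiset.sub_le_self _ _) hx), ?_, fun x hx => ?_⟩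
    fun y hy hye => ?_
  · have h₁ := congrArg Multiset.sum hadd
    have h₂ := sum_muOdd_mod_two T
    rw [Multiset.sum_add, hd.2.1] at h₁
    rw [Nat.even_iff]
    omega
  · rw [Multiset.count_sub, count_muOdd_of_even T hx, Nat.sub_zero]
    exact hd.1.2.2 x hx
  · have h₁ := congrArg (Multiset.countP fun x => Odd x ∧ y < x) hadd
    have h₂ := hd.countP_odd_mod_two (Multiset.mem_of_le (Multiset.sub_le_self _ _) hy) hye
    have h₃ := countP_mod_two_eq (s := muOdd T) (t := T) (fun x => Odd x ∧ y < x)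
      fun x hx => count_muOdd_mod_two T hx.1
    rw [Multiset.countP_add] at h₁
    rw [Nat.even_iff]
    omega

end MuOdd

/-- For a D-partition `λ` of `n ≥ 1` with `|μ(λ)| ∉ {2, 2n-2}` and
`d(λ) = (λᵗ)_D`: `|μ(λ)|` is even, `μ(λ)` is a special D-partition,
`μ(λ) ⊆ d(λ)`, and `d(λ) ∖ μ(λ)` is a special D-partition. -/
theorem statement9 (n : ℕ) (hn : 1 ≤ n) (l : Multiset ℕ)
    (hD : IsTypeD l ∧ l.sum = 2 * n)
    (hmu : (muOdd (transpose l)).sum ≠ 2 ∧ (muOdd (transpose l)).sum ≠ 2 * n - 2)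
    (d : Multiset ℕ) (hd : IsCollapse IsTypeD (transpose l) d) :
    Even (muOdd (transpose l)).sum ∧
    IsSpecialTypeD (muOdd (transpose l)) ∧
    muOdd (transpose l) ≤ d ∧
    IsSpecialTypeD (d - muOdd (transpose l)) := by
  have hT : Even (transpose l).sum := hd.2.1 ▸ hd.1.2.1
  have hs := isSpecialTypeD_muOdd hT
  exact ⟨hs.1.2.1, hs, hd.muOdd_le, hd.isSpecialTypeD_sub⟩

end WFPaper
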